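/- Define the parent map p : ℤ² → ℤ² by p(c) = (⌊c₁/2⌋, ⌊c₂/2⌋) using integer floor division, and the Chebyshev distance d_∞(c,d) = max(|c₁ − d₁|, |c₂ − d₂|). For every c ∈ ℤ², the number of children of c plus the number of near-neighbours of c, i.e. card{d ∈ ℤ² : p(d) = c} + card{d ∈ ℤ² : d_∞(p(d), p(c)) ≤ 1 and d_∞(d, c) ≥ 2}, equals 31; hence, counting also the single edge to its parent, every cell node in the hierarchy is incident to at most 32 edges. (Per-node degree bound of Theorem 2 for cell nodes.) -/

import Mathlib

/-- The quadtree parent map on cells indexed by `ℤ²`: component-wise integer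
floor division by 2. -/
def parent (c : ℤ × ℤ) : ℤ × ℤ := (Int.fdiv c.1 2, Int.fdiv c.2 2)

/-- The Chebyshev (sup) distance on `ℤ²`. -/
def dInf (c d : ℤ × ℤ) : ℤ := max |c.1 - d.1| |c.2 - d.2|

/-- The children of a cell form a `2 × 2` block. -/
theorem setOf_parent_eq (c : ℤ × ℤ) :
    {d : ℤ × ℤ | parent d = c} =
      ↑(Finset.Icc (2 * c.1) (2 * c.1 + 1) ×ˢ Finset.Icc (2 * c.2) (2 * c.2 + 1)) := by
  ext ⟨x, y⟩
  obtain ⟨a, b⟩ := c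
  simp only [parent, Set.mem_ofPred_eq, Prod.mk.injEq, Finset.coe_product, Set.mem_prod,
    Finset.mem_coe, Finset.mem_Icc, Int.fdiv_eq_ediv_of_nonneg _ (zero_le_two : (0 : ℤ) ≤ 2)]
  omega

/-- The near-neighbours of a cell are a `6 × 6` block of cells with the `3 × 3` block
centred at the cell removed. -/
theorem setOf_nearNeighbour_eq (c : ℤ × ℤ) :
    {d : ℤ × ℤ | dInf (parent d) (parent c) ≤ 1 ∧ 2 ≤ dInf d c} =
      ↑((Finset.Icc (2 * (c.1 / 2) - 2) (2 * (c.1 / 2) + 3) ×ˢ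
          Finset.Icc (2 * (c.2 / 2) - 2) (2 * (c.2 / 2) + 3)) \
        (Finset.Icc (c.1 - 1) (c.1 + 1) ×ˢ Finset.Icc (c.2 - 1) (c.2 + 1))) := by
  ext ⟨x, y⟩
  obtain ⟨a, b⟩ := c
  simp only [dInf, parent, Set.mem_ofPred_eq, Finset.mem_coe, Finset.mem_sdiff,
    Finset.mem_product, Finset.mem_Icc, max_le_iff, le_max_iff, abs_le, le_abs,
    Int.fdiv_eq_ediv_of_nonneg _ (zero_le_two : (0 : ℤ) ≤ 2)]
  omega

theorem ncard_setOf_parent_eq (c : ℤ × ℤ) : Set.ncard {d : ℤ × ℤ | parent d = c} = 4 := by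
  have h (a : ℤ) : (a + 1 + 1 - a).toNat = 2 := by omega
  rw [setOf_parent_eq, Set.ncard_coe_finset, Finset.card_product, Int.card_Icc, Int.card_Icc,
    h, h]

theorem ncard_setOf_nearNeighbour (c : ℤ × ℤ) :
    Set.ncard {d : ℤ × ℤ | dInf (parent d) (parent c) ≤ 1 ∧ 2 ≤ dInf d c} = 27 := by
  have h₃ (a : ℤ) : (a + 1 + 1 - (a - 1)).toNat = 3 := by omega
  have h₆ (a : ℤ) : (a + 3 + 1 - (a - 2)).toNat = 6 := by omega
  rw [setOf_nearNeighbour_eq, Set.ncard_coe_finset, Finset.card_sdiff_of_subset]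
  · simp only [Finset.card_product, Int.card_Icc, h₃, h₆]
  · apply Finset.product_subset_product <;> apply Finset.Icc_subset_Icc <;> omega

/-- Per-node degree bound of Theorem 2 for cell nodes: the number of children
plus the number of near-neighbours of a cell `c` equals 31; hence, counting also
the single edge to its parent, every cell node is incident to at most 32
edges. -/
theorem cell_degree_bound (c : ℤ × ℤ) :
    Set.ncard {d : ℤ × ℤ | parent d = c} +
      Set.ncard {d : ℤ × ℤ | dInf (parent d) (parent c) ≤ 1 ∧ 2 ≤ dInf d c} = 31 ∧
    Set.ncard {d : ℤ × ℤ | parent d = c} +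
      Set.ncard {d : ℤ × ℤ | dInf (parent d) (parent c) ≤ 1 ∧ 2 ≤ dInf d c} + 1 ≤ 32 := by
  rw [ncard_setOf_parent_eq, ncard_setOf_nearNeighbour]
  norm_num
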